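/- Suppose that for every integer k ≥ 3 there exist a positive integer d, a constant c > 0, a real number s > 1, and N such that for all integers n > N, r_k(n) ≤ c·n / ((∏_{i=1}^{d−1} ln^{(i)}(n))·(ln^{(d)}(n))^s). Then Erdős's conjecture holds: every set A of positive integers whose reciprocal sum diverges contains a k-term arithmetic progression for every k ≥ 3. -/

import Mathlib

/-- A set `S` of natural numbers contains a `k`-term arithmetic progression:
there are `a` and `d ≥ 1` with `a, a+d, …, a+(k-1)d` all in `S`. -/
def HasAP (k : ℕ) (S : Set ℕ) : Prop :=
  ∃ a d : ℕ, 1 ≤ d ∧ ∀ i < k, a + i * d ∈ S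

/-- `rk k n` is the maximum size of a `k`-AP-free subset of `{1, …, n}`. -/
noncomputable def rk (k n : ℕ) : ℕ :=
  sSup {m | ∃ A : Finset ℕ, A ⊆ Finset.Icc 1 n ∧ ¬ HasAP k ↑A ∧ A.card = m}

open Filter Real Topology

theorem HasAP.mono {k : ℕ} {S T : Set ℕ} (hST : S ⊆ T) (h : HasAP k S) : HasAP k T := by
  obtain ⟨a, d, hd, h⟩ := h
  exact ⟨a, d, hd, fun i hi => hST (h i hi)⟩

theorem card_le_rk {k n : ℕ} {B : Finset ℕ} (hB : B ⊆ Finset.Icc 1 n) (hAP : ¬ HasAP k ↑B) :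
    B.card ≤ rk k n := by
  refine le_csSup ⟨n, ?_⟩ ⟨B, hB, hAP, rfl⟩
  rintro m ⟨C, hC, -, rfl⟩
  simpa using Finset.card_le_card hC

theorem sum_inv_range_two_pow_le_sum_rk {k : ℕ} {A : Set ℕ} (hAP : ¬ HasAP k A) (n : ℕ) :
    ∑ m ∈ Finset.range (2 ^ n), A.indicator (fun m : ℕ => (1 : ℝ) / m) m ≤
      ∑ j ∈ Finset.range n, (rk k (2 ^ (j + 1)) : ℝ) / 2 ^ j := by
  classical
  induction n with
  | zero => simp [Set.indicator]
  | succ n ih =>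
    rw [Finset.sum_range_succ,
      ← Finset.sum_range_add_sum_Ico _ (Nat.pow_le_pow_right two_pos n.le_succ)]
    gcongr
    set B := (Finset.Ico (2 ^ n) (2 ^ (n + 1))).filter (· ∈ A) with hB
    have hcard : B.card ≤ rk k (2 ^ (n + 1)) := by
      refine card_le_rk (fun x hx => ?_) (fun h => hAP (h.mono fun x hx => ?_))
      · simp only [hB, Finset.mem_filter, Finset.mem_Ico] at hx
        exact Finset.mem_Icc.2 ⟨Nat.one_le_two_pow.trans hx.1.1, hx.1.2.le⟩
      · simp only [hB, Finset.coe_filter] at hx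
        exact hx.2
    calc ∑ m ∈ Finset.Ico (2 ^ n) (2 ^ (n + 1)), A.indicator (fun m : ℕ => (1 : ℝ) / m) m
        = ∑ m ∈ B, (1 : ℝ) / m := by
          rw [hB, Finset.sum_filter]
          rfl
      _ ≤ ∑ _m ∈ B, (1 : ℝ) / 2 ^ n := by
          refine Finset.sum_le_sum fun m hm => ?_
          simp only [hB, Finset.mem_filter, Finset.mem_Ico] at hm
          have : (2 : ℝ) ^ n ≤ m := by exact_mod_cast hm.1.1
          gcongr
      _ = (B.card : ℝ) / 2 ^ n := by simp [div_eq_mul_inv]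
      _ ≤ (rk k (2 ^ (n + 1)) : ℝ) / 2 ^ n := by gcongr

theorem summable_one_div_of_summable_rk {k : ℕ} {A : Set ℕ} (hAP : ¬ HasAP k A)
    (h : Summable fun j : ℕ => (rk k (2 ^ (j + 1)) : ℝ) / 2 ^ j) :
    Summable fun a : A => (1 : ℝ) / (a : ℕ) := by
  have hnonneg : ∀ m, 0 ≤ A.indicator (fun m : ℕ => (1 : ℝ) / m) m :=
    Set.indicator_nonneg fun m _ => by positivity
  refine (summable_subtype_iff_indicator (f := fun m : ℕ => (1 : ℝ) / m)).2 ?_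
  refine summable_of_sum_range_le (c := ∑' j : ℕ, (rk k (2 ^ (j + 1)) : ℝ) / 2 ^ j)
    hnonneg fun n => ?_
  calc ∑ m ∈ Finset.range n, A.indicator (fun m : ℕ => (1 : ℝ) / m) m
      ≤ ∑ m ∈ Finset.range (2 ^ n), A.indicator (fun m : ℕ => (1 : ℝ) / m) m :=
        Finset.sum_le_sum_of_subset_of_nonneg
          (Finset.range_mono Nat.lt_two_pow_self.le) fun m _ _ => hnonneg m
    _ ≤ _ := sum_inv_range_two_pow_le_sum_rk hAP n
    _ ≤ _ := h.sum_le_tsum _ fun j _ => by positivity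

theorem tendsto_iterate_log_atTop (m : ℕ) : Tendsto (Real.log^[m]) atTop atTop := by
  induction m with
  | zero => exact tendsto_id
  | succ m ih => exact ih.comp tendsto_log_atTop

theorem iterate_log_le_iterate_log {x y : ℝ} (hxy : x ≤ y) {m : ℕ}
    (hx : ∀ i < m, 0 < Real.log^[i] x) : Real.log^[m] x ≤ Real.log^[m] y := by
  induction m with
  | zero => exact hxy
  | succ m ih =>
    rw [Function.iterate_succ_apply', Function.iterate_succ_apply']
    exact log_le_log (hx m m.lt_succ_self) (ih fun i hi => hx i (hi.trans m.lt_succ_self))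

theorem hasDerivAt_iterate_log {x : ℝ} {m : ℕ} (hx : ∀ i < m, 0 < Real.log^[i] x) :
    HasDerivAt (Real.log^[m]) (∏ i ∈ Finset.range m, Real.log^[i] x)⁻¹ x := by
  induction m with
  | zero => simpa using hasDerivAt_id x
  | succ m ih =>
    rw [Function.iterate_succ', Finset.prod_range_succ, mul_inv_rev]
    exact (hasDerivAt_log (hx m m.lt_succ_self).ne').comp x
      (ih fun i hi => hx i (hi.trans m.lt_succ_self))

/-- The Bertrand-type weights `x ln(x) ⋯ ln^{(m-1)}(x) (ln^{(m)}(x))^s`. -/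
noncomputable def bertrandWeight (m : ℕ) (s x : ℝ) : ℝ :=
  (∏ i ∈ Finset.range m, Real.log^[i] x) * (Real.log^[m] x) ^ s

theorem bertrandWeight_pos {m : ℕ} {s x : ℝ} (hx : ∀ i ≤ m, 0 < Real.log^[i] x) :
    0 < bertrandWeight m s x :=
  mul_pos (Finset.prod_pos fun i hi => hx i (Finset.mem_range.1 hi).le)
    (rpow_pos_of_pos (hx m le_rfl) s)

theorem bertrandWeight_le {m : ℕ} {s x y : ℝ} (hs : 0 ≤ s) (hxy : x ≤ y)
    (hx : ∀ i ≤ m, 0 < Real.log^[i] x) : bertrandWeight m s x ≤ bertrandWeight m s y := by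
  have hle : ∀ i ≤ m, Real.log^[i] x ≤ Real.log^[i] y := fun i hi =>
    iterate_log_le_iterate_log hxy fun j hj => hx j (hj.le.trans hi)
  refine mul_le_mul ?_ (rpow_le_rpow (hx m le_rfl).le (hle m le_rfl) hs)
    (rpow_pos_of_pos (hx m le_rfl) s).le ?_
  · exact Finset.prod_le_prod (fun i hi => (hx i (Finset.mem_range.1 hi).le).le)
      fun i hi => hle i (Finset.mem_range.1 hi).le
  · refine Finset.prod_nonneg fun i hi => ?_
    have hi := (Finset.mem_range.1 hi).le
    exact (hx i hi).le.trans (hle i hi)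

theorem hasDerivAt_iterate_log_rpow {m : ℕ} {s x : ℝ} (hx : ∀ i ≤ m, 0 < Real.log^[i] x) :
    HasDerivAt (fun y => (Real.log^[m] y) ^ (1 - s)) ((1 - s) * (bertrandWeight m s x)⁻¹) x := by
  convert (hasDerivAt_iterate_log fun i hi => hx i hi.le).rpow_const (p := 1 - s)
    (Or.inl (hx m le_rfl).ne') using 1
  rw [bertrandWeight, mul_inv, ← rpow_neg (hx m le_rfl).le, show 1 - s - 1 = -s by ring]
  ring

theorem summable_inv_bertrandWeight {s δ : ℝ} (m : ℕ) (hs : 1 < s) (hδ : 0 < δ) :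
    Summable fun n : ℕ => (bertrandWeight m s (n * δ))⁻¹ := by
  have hpos : ∀ᶠ x : ℝ in atTop, ∀ i ≤ m, 0 < Real.log^[i] x := by
    have := (Finset.eventually_all (Finset.range (m + 1))).2 fun i _ =>
      (tendsto_iterate_log_atTop i).eventually_gt_atTop 0
    filter_upwards [this] with x hx i hi
    exact hx i (Finset.mem_range.2 (Nat.lt_succ_of_le hi))
  obtain ⟨X, hX⟩ := eventually_atTop.1 hpos
  obtain ⟨N, hN⟩ := exists_nat_ge (X / δ)
  have hX' : ∀ n : ℕ, ∀ x : ℝ, ((n + N : ℕ) : ℝ) * δ ≤ x → ∀ i ≤ m, 0 < Real.log^[i] x := by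
    intro n x hx
    refine hX x (le_trans ?_ hx)
    rw [div_le_iff₀ hδ] at hN
    refine hN.trans ?_
    push_cast
    gcongr
    simp
  set F : ℝ → ℝ := fun y => (Real.log^[m] y) ^ (1 - s) with hF
  have hC : 0 < (s - 1) * δ := mul_pos (by linarith) hδ
  have step : ∀ n : ℕ, (s - 1) * δ * (bertrandWeight m s ((n + (N + 1) : ℕ) * δ))⁻¹ ≤
      F ((n + N : ℕ) * δ) - F ((n + 1 + N : ℕ) * δ) := by
    intro n
    have hlen : ((n + 1 + N : ℕ) : ℝ) * δ - ((n + N : ℕ) : ℝ) * δ = δ := by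
      push_cast
      ring
    have hd : ∀ x : ℝ, ((n + N : ℕ) : ℝ) * δ ≤ x →
        HasDerivAt F ((1 - s) * (bertrandWeight m s x)⁻¹) x := fun x hx =>
      hasDerivAt_iterate_log_rpow (hX' n x hx)
    obtain ⟨ξ, hξ, hslope⟩ := exists_hasDerivAt_eq_slope F _
      (show ((n + N : ℕ) : ℝ) * δ < ((n + 1 + N : ℕ) : ℝ) * δ by linarith)
      (fun x hx => (hd x hx.1).continuousAt.continuousWithinAt) fun x hx => hd x hx.1.le
    rw [hlen, eq_div_iff hδ.ne'] at hslope
    have hle : (bertrandWeight m s ((n + (N + 1) : ℕ) * δ))⁻¹ ≤ (bertrandWeight m s ξ)⁻¹ := by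
      have hξpos := hX' n ξ hξ.1.le
      refine inv_anti₀ (bertrandWeight_pos hξpos) (bertrandWeight_le (by linarith) ?_ hξpos)
      rw [show n + (N + 1) = n + 1 + N by ring]
      exact hξ.2.le
    have := mul_le_mul_of_nonneg_left hle hC.le
    linarith
  rw [← summable_nat_add_iff (N + 1), ← summable_mul_left_iff hC.ne']
  refine summable_of_sum_range_le (c := F ((0 + N : ℕ) * δ)) (fun n => ?_) fun n => ?_
  · refine mul_nonneg hC.le (inv_nonneg.2 (bertrandWeight_pos (hX' n _ ?_)).le)
    gcongr
    simp
  · refine (Finset.sum_le_sum fun i _ => step i).trans ?_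
    rw [Finset.sum_range_sub' fun i : ℕ => F ((i + N : ℕ) * δ)]
    have : 0 ≤ F ((n + N : ℕ) * δ) := rpow_nonneg (hX' n _ le_rfl m le_rfl).le _
    linarith

theorem prod_iterate_log_two_pow_mul_rpow (m n : ℕ) (s : ℝ) :
    (∏ i ∈ Finset.Icc 1 m, Real.log^[i] ((2 ^ n : ℕ) : ℝ)) *
      (Real.log^[m + 1] ((2 ^ n : ℕ) : ℝ)) ^ s = bertrandWeight m s (n * Real.log 2) := by
  have h : ∀ i, Real.log^[i + 1] ((2 ^ n : ℕ) : ℝ) = Real.log^[i] (n * Real.log 2) := fun i => by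
    simp [Function.iterate_succ_apply, log_pow]
  rw [bertrandWeight, h, Finset.range_eq_Ico, ← Finset.Ico_add_one_right_eq_Icc,
    ← Finset.prod_Ico_add' _ 0 m 1]
  simp only [h]

theorem erdos_conjecture_of_upper_bounds
    (hyp : ∀ k : ℕ, 3 ≤ k →
      ∃ d : ℕ, 1 ≤ d ∧ ∃ c : ℝ, 0 < c ∧ ∃ s : ℝ, 1 < s ∧ ∃ N : ℕ, ∀ n : ℕ, N < n →
        (rk k n : ℝ) ≤ c * (n : ℝ) /
          ((∏ i ∈ Finset.Icc 1 (d - 1), Real.log^[i] (n : ℝ)) *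
            (Real.log^[d] (n : ℝ)) ^ s)) :
    ∀ A : Set ℕ, (∀ x ∈ A, 1 ≤ x) →
      ¬ Summable (fun a : A => (1 : ℝ) / (a : ℕ)) →
      ∀ k : ℕ, 3 ≤ k → HasAP k A := by
  intro A _ hA k hk
  by_contra hAP
  refine hA (summable_one_div_of_summable_rk hAP ?_)
  obtain ⟨d, hd, c, -, s, hs, N, hN⟩ := hyp k hk
  obtain ⟨m, rfl⟩ := Nat.exists_eq_add_of_le' hd
  have hsum := ((summable_nat_add_iff 1).2
    (summable_inv_bertrandWeight m hs (log_pos one_lt_two))).mul_left (2 * c)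
  refine Summable.of_norm_bounded_eventually_nat hsum ?_
  filter_upwards [eventually_ge_atTop N] with n hn
  have h := hN (2 ^ (n + 1)) (hn.trans_lt (n.lt_succ_self.trans Nat.lt_two_pow_self))
  rw [Nat.add_sub_cancel, prod_iterate_log_two_pow_mul_rpow] at h
  rw [norm_of_nonneg (by positivity), div_le_iff₀ (by positivity)]
  refine h.trans_eq ?_
  push_cast
  ring
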